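/- For persistence diagrams a, b ∈ D^∞ (ℕ-valued point measures on Ω with points at uniformly bounded distance from the diagonal), the optimal partial transport bottleneck distance OT_∞(a,b) := inf_{π ∈ Adm(a,b)} sup{d(x,y) : (x,y) ∈ spt(π)} equals the classical bottleneck distance d_∞(a,b) = inf over partial matchings π of sup_{x ∈ a∪∂Ω} ‖x − π(x)‖. -/

import Mathlib

noncomputable section

open MeasureTheory Metric Set Filter Topology ENNReal
open scoped Classical

/-- The plane with the Euclidean distance. -/
abbrev Pt : Type := EuclideanSpace ℝ (Fin 2)

/-- Build a point of the plane from coordinates. -/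
def mk2 (a b : ℝ) : Pt := (WithLp.equiv 2 (Fin 2 → ℝ)).symm ![a, b]

/-- The open upper half-plane Ω = {(t₁,t₂) : t₂ > t₁}. -/
def UHP : Set Pt := {x | x 0 < x 1}

/-- The diagonal ∂Ω = {(t,t)}. -/
def Diag : Set Pt := {x | x 0 = x 1}

/-- Ω̄ = Ω ∪ ∂Ω. -/
def UHPbar : Set Pt := UHP ∪ Diag

/-- Distance from a point to the diagonal. -/
def persDist (x : Pt) : ℝ := infDist x Diag

/-- p-th total persistence Pers_p(μ) = ∫_Ω d(x,∂Ω)^p dμ(x). -/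
def Pers (p : ℝ) (μ : Measure Pt) : ℝ≥0∞ :=
  ∫⁻ x in UHP, ENNReal.ofReal (persDist x ^ p) ∂μ

/-- μ ∈ M^p : a measure supported on Ω with finite p-th persistence. -/
def MemMp (p : ℝ) (μ : Measure Pt) : Prop := μ UHPᶜ = 0 ∧ Pers p μ < ⊤

/-- Admissible partial transport plans between μ and ν: measures on Ω̄ × Ω̄ whose
marginals restricted to Ω are μ and ν. -/
def Adm (μ ν : Measure Pt) : Set (Measure (Pt × Pt)) :=
  {π | π ((UHPbar ×ˢ UHPbar)ᶜ) = 0 ∧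
    (∀ A : Set Pt, MeasurableSet A → A ⊆ UHP → π (A ×ˢ univ) = μ A) ∧
    (∀ B : Set Pt, MeasurableSet B → B ⊆ UHP → π (univ ×ˢ B) = ν B)}

/-- Cost C_p(π) = ∬ d(x,y)^p dπ(x,y). -/
def Cost (p : ℝ) (π : Measure (Pt × Pt)) : ℝ≥0∞ :=
  ∫⁻ z, ENNReal.ofReal (dist z.1 z.2 ^ p) ∂π

/-- OT_p(μ,ν)^p, as an extended real. -/
def OTe (p : ℝ) (μ ν : Measure Pt) : ℝ≥0∞ := ⨅ π ∈ Adm μ ν, Cost p π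

/-- The optimal partial transport distance OT_p(μ,ν). -/
def OT (p : ℝ) (μ ν : Measure Pt) : ℝ := (OTe p μ ν ^ (1 / p)).toReal

/-- Optimal plans. -/
def OptSet (p : ℝ) (μ ν : Measure Pt) : Set (Measure (Pt × Pt)) :=
  {π | π ∈ Adm μ ν ∧ Cost p π = OTe p μ ν}

/-- Vague convergence of measures on Ω: convergence of integrals of continuous
functions compactly supported in Ω. -/
def VagueTendsto (μs : ℕ → Measure Pt) (μ : Measure Pt) : Prop :=
  ∀ f : Pt → ℝ, Continuous f → HasCompactSupport f → tsupport f ⊆ UHP →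
    Tendsto (fun n => ∫ x, f x ∂(μs n)) atTop (𝓝 (∫ x, f x ∂μ))

/-- E_Ω = (Ω̄ × Ω̄) \ (∂Ω × ∂Ω). -/
def EOm : Set (Pt × Pt) := (UHPbar ×ˢ UHPbar) \ (Diag ×ˢ Diag)

/-- Vague convergence of plans on E_Ω. -/
def VaguePlanTendsto (πs : ℕ → Measure (Pt × Pt)) (π : Measure (Pt × Pt)) : Prop :=
  ∀ f : Pt × Pt → ℝ, Continuous f → HasCompactSupport f → tsupport f ⊆ EOm →
    Tendsto (fun n => ∫ z, f z ∂(πs n)) atTop (𝓝 (∫ z, f z ∂π))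

/-- A persistence diagram: an ℕ-valued point measure Σ_{x ∈ X} n_x δ_x with
X ⊆ Ω locally finite in Ω. -/
def IsDiagram (μ : Measure Pt) : Prop :=
  ∃ (X : Set Pt) (n : Pt → ℕ), X ⊆ UHP ∧
    (∀ x ∈ UHP, ∃ U ∈ 𝓝 x, (X ∩ U).Finite) ∧
    μ = Measure.sum (fun x : X => (n x.1 : ℝ≥0∞) • Measure.dirac (x.1 : Pt))

/-- Support of a measure on Pt × Pt. -/
def msupp (π : Measure (Pt × Pt)) : Set (Pt × Pt) := {z | ∀ U ∈ 𝓝 z, π U ≠ 0}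

/-- Support of a measure on Pt. -/
def suppM (μ : Measure Pt) : Set Pt := {x | ∀ U ∈ 𝓝 x, μ U ≠ 0}

/-- Bottleneck cost of a plan: sup of d(x,y) over the support. -/
def CostInf (π : Measure (Pt × Pt)) : ℝ≥0∞ :=
  ⨆ z ∈ msupp π, ENNReal.ofReal (dist z.1 z.2)

/-- The bottleneck (∞) optimal partial transport distance, as extended real. -/
def OTinfE (μ ν : Measure Pt) : ℝ≥0∞ := ⨅ π ∈ Adm μ ν, CostInf π

/-- μ ∈ M^∞ : support at bounded distance from the diagonal. -/
def MemMinf (μ : Measure Pt) : Prop :=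
  μ UHPᶜ = 0 ∧ ∃ C : ℝ, ∀ x ∈ suppM μ, persDist x ≤ C

/-- A partial matching between two indexed families: a bijection between
subsets of the index sets; unmatched points are sent to the diagonal. -/
structure Matching (ι κ : Type*) where
  I : Set ι
  J : Set κ
  e : I ≃ J

/-- Cost of a partial matching for d_p (as the p-th power, extended real). -/
def mCost (p : ℝ) {ι κ : Type*} (x : ι → Pt) (y : κ → Pt) (m : Matching ι κ) : ℝ≥0∞ :=
  (∑' i : m.I, ENNReal.ofReal (dist (x i.1) (y (m.e i).1) ^ p))
  + (∑' i : ↥(m.Iᶜ), ENNReal.ofReal (persDist (x i.1) ^ p))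
  + (∑' j : ↥(m.Jᶜ), ENNReal.ofReal (persDist (y j.1) ^ p))

/-- Bottleneck cost of a partial matching. -/
def mCostInf {ι κ : Type*} (x : ι → Pt) (y : κ → Pt) (m : Matching ι κ) : ℝ≥0∞ :=
  (⨆ i : m.I, ENNReal.ofReal (dist (x i.1) (y (m.e i).1)))
  ⊔ (⨆ i : ↥(m.Iᶜ), ENNReal.ofReal (persDist (x i.1)))
  ⊔ (⨆ j : ↥(m.Jᶜ), ENNReal.ofReal (persDist (y j.1)))

/-- The point measure associated to an indexed family of points. -/
def famMeasure {ι : Type*} (x : ι → Pt) : Measure Pt :=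
  Measure.sum (fun i => Measure.dirac (x i))

/-- The weighted measure μ^p, with density d(x,∂Ω)^p with respect to μ. -/
def wgt (p : ℝ) (μ : Measure Pt) : Measure Pt :=
  μ.withDensity (fun x => ENNReal.ofReal (persDist x ^ p))

/-- The quotient space Ω̃ = Ω ⊔ {∂Ω}. -/
def Qt : Type := Option ↥UHP

/-- The quotient metric ρ on Ω̃. -/
def ρQ : Qt → Qt → ℝ
  | some x, some y => min (dist (x : Pt) (y : Pt)) (persDist x + persDist y)
  | some x, none => persDist x
  | none, some y => persDist y
  | none, none => 0

/-- The quotient metric ρ viewed on the plane, all diagonal points being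
identified. -/
def ρP (x y : Pt) : ℝ :=
  if x ∈ Diag then (if y ∈ Diag then 0 else persDist y)
  else if y ∈ Diag then persDist x
  else min (dist x y) (persDist x + persDist y)

/-- Couplings with full (equal-mass) marginals. -/
def Coup (μ ν : Measure Pt) : Set (Measure (Pt × Pt)) :=
  {π | π.map Prod.fst = μ ∧ π.map Prod.snd = ν}

/-- The p-Wasserstein distance (to the p) for the quotient metric ρ. -/
def WpE (p : ℝ) (μ ν : Measure Pt) : ℝ≥0∞ :=
  ⨅ π ∈ Coup μ ν, ∫⁻ z, ENNReal.ofReal (ρP z.1 z.2 ^ p) ∂π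


lemma fam_apply {ι : Type} (x : ι → Pt) {A : Set Pt} (hA : MeasurableSet A) :
    famMeasure x A = ((x ⁻¹' A).encard : ℝ≥0∞) := by
  rw [famMeasure, Measure.sum_apply _ hA, ← ENNReal.tsum_set_one,
    tsum_subtype (x ⁻¹' A) (fun _ => (1 : ℝ≥0∞))]
  refine tsum_congr fun i => ?_
  rw [Measure.dirac_apply' _ hA]
  simp [Set.indicator]

lemma measurable_UHP : MeasurableSet UHP := by
  have h0 : Continuous fun x : Pt => x 0 := by fun_prop
  have h1 : Continuous fun x : Pt => x 1 := by fun_prop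
  exact (isOpen_lt h0 h1).measurableSet

lemma mem_bar (x : Pt) : x ∈ UHPbar ↔ x 0 ≤ x 1 := by
  simp [UHPbar, UHP, Diag, le_iff_lt_or_eq]

lemma closed_bar : IsClosed UHPbar := by
  have h0 : Continuous fun x : Pt => x 0 := by fun_prop
  have h1 : Continuous fun x : Pt => x 1 := by fun_prop
  have : UHPbar = {x : Pt | x 0 ≤ x 1} := by ext x; exact mem_bar x
  rw [this]; exact isClosed_le h0 h1

lemma closed_Diag : IsClosed Diag := by
  have h0 : Continuous fun x : Pt => x 0 := by fun_prop
  have h1 : Continuous fun x : Pt => x 1 := by fun_prop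
  exact isClosed_eq h0 h1

lemma exists_proj (x : Pt) : ∃ z ∈ Diag, dist x z = persDist x := by
  obtain ⟨z, hz, h⟩ := closed_Diag.exists_infDist_eq_dist ⟨0, by simp [Diag]⟩ x
  exact ⟨z, hz, h.symm⟩

lemma diag_finite {μ : Measure Pt} (h : IsDiagram μ) {K : Set Pt} (hK : IsCompact K)
    (hKU : K ⊆ UHP) : μ K < ⊤ := by
  obtain ⟨X, n, hX, hloc, rfl⟩ := h
  refine hK.measure_lt_top_of_nhdsWithin fun x hx => ?_
  obtain ⟨U, hU, hfin⟩ := hloc x (hKU hx)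
  refine ⟨interior U, mem_nhdsWithin_of_mem_nhds (interior_mem_nhds.2 hU), ?_⟩
  rw [Measure.sum_apply _ isOpen_interior.measurableSet]
  have hf : {z : X | z.1 ∈ U}.Finite := by
    refine Set.Finite.of_finite_image (f := Subtype.val) (hfin.subset ?_) Subtype.val_injective.injOn
    rintro _ ⟨z, hz, rfl⟩
    exact ⟨z.2, hz⟩
  rw [tsum_eq_sum (s := hf.toFinset)]
  · refine ENNReal.sum_lt_top.2 fun z _ => ?_
    rw [Measure.smul_apply, Measure.dirac_apply' _ isOpen_interior.measurableSet, smul_eq_mul]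
    refine ENNReal.mul_lt_top (by simp) ?_
    by_cases hz : z.1 ∈ interior U <;> simp [hz]
  · intro z hz
    rw [Measure.smul_apply, Measure.dirac_apply' _ isOpen_interior.measurableSet, smul_eq_mul]
    have : z.1 ∉ interior U := fun h => hz (by simpa using interior_subset h)
    simp [this]

/-- the target region of a point far from the diagonal -/
def reg (u : Pt) (r : ℝ) : Set Pt := closedBall u r ∩ UHPbar

lemma reg_compact (u : Pt) (r : ℝ) : IsCompact (reg u r) :=
  (isCompact_closedBall u r).inter_right closed_bar

lemma reg_sub {u : Pt} {r : ℝ} (h : r < persDist u) : reg u r ⊆ UHP := by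
  rintro v ⟨hv, hb⟩
  rcases hb with hb | hb
  · exact hb
  · exfalso
    have h1 : persDist u ≤ dist u v := infDist_le_dist_of_mem hb
    rw [mem_closedBall, dist_comm] at hv
    linarith

lemma hall_inj {ι κ : Type} (x : ι → Pt) (y : κ → Pt) (hx : ∀ i, x i ∈ UHP)
    (hyd : IsDiagram (famMeasure y)) (r : ℝ)
    (H : ∀ A B : Set Pt, MeasurableSet A → MeasurableSet B → A ⊆ UHP → B ⊆ UHP →
      (∀ u ∈ A, ∀ v ∈ UHPbar, dist u v ≤ r → v ∈ B) → famMeasure x A ≤ famMeasure y B) :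
    ∃ f : {i | r < persDist (x i)} → κ, Function.Injective f ∧
      ∀ i, dist (x i.1) (y (f i)) ≤ r := by
  have hfin : ∀ i : {i | r < persDist (x i)}, (y ⁻¹' reg (x i.1) r).Finite := by
    intro i
    have := diag_finite hyd (reg_compact (x i.1) r) (reg_sub i.2)
    rw [fam_apply y (reg_compact _ _).measurableSet] at this
    rw [← Set.encard_lt_top_iff]
    simpa using this
  obtain ⟨f, hf, hf'⟩ := (Finset.all_card_le_biUnion_card_iff_exists_injective
    (fun i => (hfin i).toFinset)).1 (by
      intro S
      have hA : (x '' (Subtype.val '' (S : Set {i | r < persDist (x i)}))).Finite :=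
        (S.finite_toSet.image _).image _
      have hB : IsCompact (⋃ i ∈ S, reg (x i.1) r) :=
        S.isCompact_biUnion fun i _ => reg_compact _ _
      have := H _ (⋃ i ∈ S, reg (x i.1) r) hA.measurableSet hB.measurableSet
        (by rintro _ ⟨i, _, rfl⟩; exact hx i)
        (by
          intro v hv
          simp only [mem_iUnion] at hv
          obtain ⟨i, _, hv⟩ := hv
          exact reg_sub i.2 hv)
        (by
          rintro _ ⟨_, ⟨i, hi, rfl⟩, rfl⟩ v hv hd
          simp only [mem_iUnion]
          exact ⟨i, hi, by rwa [mem_closedBall, dist_comm], hv⟩)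
      rw [fam_apply _ hA.measurableSet, fam_apply _ hB.measurableSet] at this
      have h1 : (Subtype.val '' (S : Set {i | r < persDist (x i)})).encard ≤
        (y ⁻¹' (⋃ i ∈ S, reg (x i.1) r)).encard :=
        (encard_le_encard (subset_preimage_image x _)).trans (by simpa using this)
      rw [Subtype.val_injective.encard_image, Set.encard_coe_eq_coe_finsetCard] at h1
      have h2 : y ⁻¹' (⋃ i ∈ S, reg (x i.1) r) =
          ((S.biUnion fun i => (hfin i).toFinset : Finset κ) : Set κ) := by
        ext j; simp
      rw [h2, Set.encard_coe_eq_coe_finsetCard] at h1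
      exact_mod_cast h1)
  refine ⟨f, hf, fun i => ?_⟩
  have := hf' i
  simp only [Set.Finite.mem_toFinset, mem_preimage] at this
  rw [dist_comm]; exact this.1

/-- Alternating closure used in the Schröder–Bernstein style argument. -/
inductive Reach {ι κ : Type} {I : Set ι} {J : Set κ} (f : I → κ) (g : J → ι) : ι → Prop
  | base (i : ι) (h : i ∈ I) (h' : ∀ j, g j ≠ i) : Reach f g i
  | step (i : I) (h : f i ∈ J) : Reach f g i.1 → Reach f g (g ⟨f i, h⟩)

lemma alternating_matching {ι κ : Type} {I : Set ι} {J : Set κ} (f : I → κ) (g : J → ι)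
    (hf : Function.Injective f) (hg : Function.Injective g) :
    ∃ R : ι → κ → Prop, (∀ i j, R i j → (∃ h : i ∈ I, f ⟨i, h⟩ = j) ∨ (∃ h : j ∈ J, g ⟨j, h⟩ = i)) ∧
      (∀ i j j', R i j → R i j' → j = j') ∧ (∀ i i' j, R i j → R i' j → i = i') ∧
      (∀ i ∈ I, ∃ j, R i j) ∧ (∀ j ∈ J, ∃ i, R i j) := by
  refine ⟨fun i j => (Reach f g i ∧ ∃ h : i ∈ I, f ⟨i, h⟩ = j) ∨
    (¬ Reach f g i ∧ ∃ h : j ∈ J, g ⟨j, h⟩ = i), ?_, ?_, ?_, ?_, ?_⟩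
  · rintro i j (⟨_, h⟩ | ⟨_, h⟩)
    exacts [Or.inl h, Or.inr h]
  · rintro i j j' (⟨h1, h, rfl⟩ | ⟨h1, h, rfl⟩) (⟨h1', h', e⟩ | ⟨h1', h', e⟩)
    · exact e
    · exact absurd h1 h1'
    · exact absurd h1' h1
    · exact (congrArg Subtype.val (hg e)).symm
  · rintro i i' j (⟨h1, h, e⟩ | ⟨h1, h, e⟩) (⟨h1', h', e'⟩ | ⟨h1', h', e'⟩)
    · exact congrArg Subtype.val (hf (e.trans e'.symm))
    · subst e; subst e'
      exact absurd (Reach.step ⟨i, h⟩ h' h1) h1'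
    · subst e'; subst e
      exact absurd (Reach.step ⟨i', h'⟩ h h1') h1
    · exact e.symm.trans e'
  · intro i hi
    by_cases h : Reach f g i
    · exact ⟨_, Or.inl ⟨h, hi, rfl⟩⟩
    · have : ∃ j, g j = i := by
        by_contra! hc
        exact h (Reach.base i hi hc)
      obtain ⟨j, hj⟩ := this
      exact ⟨j.1, Or.inr ⟨h, j.2, hj⟩⟩
  · intro j hj
    by_cases h : Reach f g (g ⟨j, hj⟩)
    · generalize e : g ⟨j, hj⟩ = i at h
      cases h with
      | base _ h h' => exact absurd e (h' _)
      | step i h hr =>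
        have := congrArg Subtype.val (hg e)
        exact ⟨i.1, Or.inl ⟨hr, i.2, this.symm⟩⟩
    · exact ⟨_, Or.inr ⟨h, hj, rfl⟩⟩

lemma exists_matching {ι κ : Type} (R : ι → κ → Prop)
    (h1 : ∀ i j j', R i j → R i j' → j = j') (h2 : ∀ i i' j, R i j → R i' j → i = i') :
    ∃ m : Matching ι κ, (∀ i : m.I, R i.1 (m.e i).1) ∧ (∀ i, i ∈ m.I ↔ ∃ j, R i j) ∧
      (∀ j, j ∈ m.J ↔ ∃ i, R i j) := by
  refine ⟨⟨{i | ∃ j, R i j}, {j | ∃ i, R i j},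
    { toFun := fun i => ⟨i.2.choose, i.1, i.2.choose_spec⟩
      invFun := fun j => ⟨j.2.choose, j.1, j.2.choose_spec⟩
      left_inv := fun i => Subtype.ext (h2 _ _ _ (Exists.choose_spec (p := fun k => R k _) _)
        i.2.choose_spec)
      right_inv := fun j => Subtype.ext (h1 _ _ _ (Exists.choose_spec (p := fun k => R _ k) _)
        j.2.choose_spec) }⟩, fun i => i.2.choose_spec, fun i => Iff.rfl, fun j => Iff.rfl⟩

lemma null_compl_msupp (π : Measure (Pt × Pt)) : π (msupp π)ᶜ = 0 := by
  refine measure_null_of_locally_null _ fun z hz => ?_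
  simp only [msupp, mem_compl_iff, mem_ofPred_eq, not_forall, not_not] at hz
  obtain ⟨U, hU, h⟩ := hz
  exact ⟨U, mem_nhdsWithin_of_mem_nhds hU, h⟩

lemma le_dir {ι κ : Type} (x : ι → Pt) (y : κ → Pt) (hx : ∀ i, x i ∈ UHP) (hy : ∀ j, y j ∈ UHP)
    (hxd : IsDiagram (famMeasure x)) (hyd : IsDiagram (famMeasure y))
    (π : Measure (Pt × Pt)) (hπ : π ∈ Adm (famMeasure x) (famMeasure y)) :
    ⨅ m : Matching ι κ, mCostInf x y m ≤ CostInf π := by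
  by_cases hT : CostInf π = ⊤
  · rw [hT]; exact le_top
  obtain ⟨h0, hA, hB⟩ := hπ
  set r := (CostInf π).toReal with hr
  have hcost : ∀ d : ℝ, ENNReal.ofReal d ≤ CostInf π ↔ d ≤ r := by
    intro d
    rw [hr, ENNReal.ofReal_le_iff_le_toReal hT]
  have hn : ∀ᵐ z ∂π, z.1 ∈ UHPbar ∧ z.2 ∈ UHPbar ∧ dist z.1 z.2 ≤ r := by
    have e1 : ∀ᵐ z ∂π, z ∈ UHPbar ×ˢ UHPbar := h0
    have e2 : ∀ᵐ z ∂π, z ∈ msupp π := null_compl_msupp π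
    filter_upwards [e1, e2] with z hz1 hz2
    exact ⟨hz1.1, hz1.2, (hcost _).1
      (le_iSup₂ (f := fun z (_ : z ∈ msupp π) => ENNReal.ofReal (dist z.1 z.2)) z hz2)⟩
  obtain ⟨f, hf, hfd⟩ := hall_inj x y hx hyd r (by
    intro A B mA mB sA sB h
    rw [← hA A mA sA, ← hB B mB sB]
    refine measure_mono_ae ?_
    filter_upwards [hn] with z hz hzA
    exact ⟨trivial, h _ hzA.1 _ hz.2.1 hz.2.2⟩)
  obtain ⟨g, hg, hgd⟩ := hall_inj y x hy hxd r (by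
    intro A B mA mB sA sB h
    rw [← hB A mA sA, ← hA B mB sB]
    refine measure_mono_ae ?_
    filter_upwards [hn] with z hz hzA
    exact ⟨h _ hzA.2 _ hz.1 (by rw [dist_comm]; exact hz.2.2), trivial⟩)
  obtain ⟨R, hR, u1, u2, c1, c2⟩ := alternating_matching f g hf hg
  obtain ⟨m, me, mI, mJ⟩ := exists_matching R u1 u2
  refine (iInf_le _ m).trans ?_
  refine sup_le (sup_le ?_ ?_) ?_
  · refine iSup_le fun i => (hcost _).2 ?_
    rcases hR _ _ (me i) with ⟨h, e⟩ | ⟨h, e⟩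
    · have := hfd ⟨i.1, h⟩
      rw [e] at this
      exact this
    · have := hgd ⟨(m.e i).1, h⟩
      rw [e, dist_comm] at this
      exact this
  · refine iSup_le fun i => (hcost _).2 ?_
    by_contra! hc
    exact i.2 ((mI _).2 (c1 _ hc))
  · refine iSup_le fun j => (hcost _).2 ?_
    by_contra! hc
    exact j.2 ((mJ _).2 (c2 _ hc))

lemma sum_dirac_apply {α : Type} (p : α → Pt × Pt) {A : Set (Pt × Pt)} (hA : MeasurableSet A) :
    Measure.sum (fun a => Measure.dirac (p a)) A = ∑' a, A.indicator 1 (p a) := by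
  rw [Measure.sum_apply _ hA]
  exact tsum_congr fun a => Measure.dirac_apply' _ hA

lemma fam_tsum {ι : Type} (x : ι → Pt) {A : Set Pt} (hA : MeasurableSet A) :
    famMeasure x A = ∑' i, A.indicator 1 (x i) := by
  rw [famMeasure, Measure.sum_apply _ hA]
  exact tsum_congr fun a => Measure.dirac_apply' _ hA

lemma tsum_split {ι : Type} (s : Set ι) (F : ι → ℝ≥0∞) :
    ∑' i, F i = ∑' i : s, F i + ∑' i : ↥sᶜ, F i :=
  (ENNReal.summable.tsum_add_tsum_compl ENNReal.summable).symm

lemma ge_dir {ι κ : Type} (x : ι → Pt) (y : κ → Pt) (hx : ∀ i, x i ∈ UHP) (hy : ∀ j, y j ∈ UHP)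
    (m : Matching ι κ) :
    OTinfE (famMeasure x) (famMeasure y) ≤ mCostInf x y m := by
  choose P hP hPd using exists_proj
  let p : (m.I ⊕ ↥(m.Iᶜ)) ⊕ ↥(m.Jᶜ) → Pt × Pt :=
    Sum.elim (Sum.elim (fun i => (x i.1, y (m.e i).1)) (fun i => (x i.1, P (x i.1))))
      (fun j => (P (y j.1), y j.1))
  let π : Measure (Pt × Pt) := Measure.sum (fun a => Measure.dirac (p a))
  have hDiag : ∀ {A : Set Pt}, A ⊆ UHP → ∀ z, P z ∉ A := by
    intro A h z hz
    have h1 : P z 0 < P z 1 := h hz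
    have h2 : P z 0 = P z 1 := hP z
    exact h1.ne h2
  have hadm : π ∈ Adm (famMeasure x) (famMeasure y) := by
    refine ⟨?_, ?_, ?_⟩
    · have hm : MeasurableSet (UHPbar ×ˢ UHPbar)ᶜ :=
        (closed_bar.measurableSet.prod closed_bar.measurableSet).compl
      rw [sum_dirac_apply p hm, ENNReal.tsum_eq_zero]
      intro a
      refine indicator_of_notMem ?_ _
      rw [notMem_compl_iff]
      rcases a with (i | i) | j
      · exact ⟨Or.inl (hx _), Or.inl (hy _)⟩
      · exact ⟨Or.inl (hx _), Or.inr (hP _)⟩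
      · exact ⟨Or.inr (hP _), Or.inl (hy _)⟩
    · intro A mA sA
      rw [sum_dirac_apply p (mA.prod MeasurableSet.univ), fam_tsum x mA,
        ENNReal.summable.tsum_sum ENNReal.summable, ENNReal.summable.tsum_sum ENNReal.summable,
        tsum_split m.I]
      have : ∀ j : ↥(m.Jᶜ), (A ×ˢ (univ : Set Pt)).indicator (1 : Pt × Pt → ℝ≥0∞) (p (Sum.inr j)) = 0 :=
        fun j => indicator_of_notMem (fun h => hDiag sA _ h.1) _
      simp only [this, tsum_zero, add_zero]
      congr 1 <;> refine tsum_congr fun i => ?_ <;> simp [p, indicator]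
    · intro B mB sB
      rw [sum_dirac_apply p (MeasurableSet.univ.prod mB), fam_tsum y mB,
        ENNReal.summable.tsum_sum ENNReal.summable, ENNReal.summable.tsum_sum ENNReal.summable,
        tsum_split m.J]
      have : ∀ i : ↥(m.Iᶜ), ((univ : Set Pt) ×ˢ B).indicator (1 : Pt × Pt → ℝ≥0∞)
          (p (Sum.inl (Sum.inr i))) = 0 :=
        fun j => indicator_of_notMem (fun h => hDiag sB _ h.2) _
      simp only [this, tsum_zero, add_zero]
      congr 1
      · rw [← m.e.tsum_eq]
        refine tsum_congr fun i => ?_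
        simp [p, indicator]
      · refine tsum_congr fun i => ?_
        simp [p, indicator]
  refine (iInf₂_le π hadm).trans (iSup₂_le fun z hz => ?_)
  by_contra! hc
  have ho : IsOpen {z : Pt × Pt | mCostInf x y m < ENNReal.ofReal (dist z.1 z.2)} :=
    isOpen_lt continuous_const (ENNReal.continuous_ofReal.comp continuous_dist)
  refine hz _ (ho.mem_nhds hc) ?_
  rw [sum_dirac_apply p ho.measurableSet, ENNReal.tsum_eq_zero]
  intro a
  refine indicator_of_notMem ?_ _
  change ¬ (mCostInf x y m < ENNReal.ofReal (dist (p a).1 (p a).2))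
  rw [not_lt]
  rcases a with (i | i) | j
  · exact (le_iSup (fun i : m.I => ENNReal.ofReal (dist (x i.1) (y (m.e i).1))) i).trans
      (le_sup_left.trans le_sup_left)
  · simp only [p, Sum.elim_inl, Sum.elim_inr, hPd]
    exact (le_iSup (fun i : ↥(m.Iᶜ) => ENNReal.ofReal (persDist (x i.1))) i).trans
      (le_sup_right.trans le_sup_left)
  · simp only [p, Sum.elim_inr]
    rw [dist_comm, hPd]
    exact (le_iSup (fun j : ↥(m.Jᶜ) => ENNReal.ofReal (persDist (y j.1))) j).trans
      le_sup_right

/-- for persistence diagrams a,b ∈ D^∞, the bottleneck optimal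
partial transport distance equals the classical bottleneck matching distance. -/
theorem stmt13 {ι κ : Type} [Countable ι] [Countable κ]
    (x : ι → Pt) (y : κ → Pt) (hx : ∀ i, x i ∈ UHP) (hy : ∀ j, y j ∈ UHP)
    (hxd : IsDiagram (famMeasure x)) (hyd : IsDiagram (famMeasure y))
    (ha : MemMinf (famMeasure x)) (hb : MemMinf (famMeasure y)) :
    OTinfE (famMeasure x) (famMeasure y) = ⨅ m : Matching ι κ, mCostInf x y m := by
  exact le_antisymm (le_iInf fun m => ge_dir x y hx hy m)
    (le_iInf₂ fun π hπ => le_dir x y hx hy hxd hyd π hπ)
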